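/- arXiv:1012.0076 — 6 statements merged into one kernel-verified Lean document; each statement's English description precedes it below -/
import Mathlib

section
/- Let c(ε,θ) be a smooth variation of closed planar curves and δc := ∂_ε c. Then the variation of the curvature satisfies, at every (ε,θ), ∂_ε κ = D_θ²(δc · n) + κ²·(δc · n) + (D_θ κ)·(δc · τ). -/
noncomputable section

/-- Euclidean dot product on `ℝ × ℝ`. -/
def dotp (x y : ℝ × ℝ) : ℝ := x.1 * y.1 + x.2 * y.2

/-- Euclidean norm on `ℝ × ℝ`. -/
def nrm (x : ℝ × ℝ) : ℝ := Real.sqrt (dotp x x)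

/-- Rotation of the plane by `π/2`, with matrix rows `(0, -1)`, `(1, 0)`. -/
def Jrot (x : ℝ × ℝ) : ℝ × ℝ := (-x.2, x.1)

/-- The θ-derivative `c_θ` of a curve. -/
def cder (γ : ℝ → ℝ × ℝ) (θ : ℝ) : ℝ × ℝ := deriv γ θ

/-- The speed `|c_θ|`. -/
def speed (γ : ℝ → ℝ × ℝ) (θ : ℝ) : ℝ := nrm (cder γ θ)

/-- Arclength derivative `D_θ` of a scalar function along the curve `γ`. -/
def Dth (γ : ℝ → ℝ × ℝ) (f : ℝ → ℝ) (θ : ℝ) : ℝ := (speed γ θ)⁻¹ * deriv f θ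

/-- Arclength derivative `D_θ` of a vector-valued function along the curve `γ`. -/
def DthV (γ : ℝ → ℝ × ℝ) (f : ℝ → ℝ × ℝ) (θ : ℝ) : ℝ × ℝ := (speed γ θ)⁻¹ • deriv f θ

/-- Unit tangent vector `τ = c_θ / |c_θ|`. -/
def tang (γ : ℝ → ℝ × ℝ) (θ : ℝ) : ℝ × ℝ := (speed γ θ)⁻¹ • cder γ θ

/-- Unit normal vector `n = Jτ`. -/
def nvec (γ : ℝ → ℝ × ℝ) (θ : ℝ) : ℝ × ℝ := Jrot (tang γ θ)

/-- Curvature `κ = (D_θ τ) · n`. -/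
def curv (γ : ℝ → ℝ × ℝ) (θ : ℝ) : ℝ := dotp (DthV γ (tang γ) θ) (nvec γ θ)

/-- A closed planar curve: `1`-periodic with nowhere-vanishing θ-derivative. -/
def IsClosedCurve (γ : ℝ → ℝ × ℝ) : Prop :=
  (∀ θ, γ (θ + 1) = γ θ) ∧ ∀ θ, deriv γ θ ≠ 0

def pt (F : ℝ × ℝ → ℝ) (p : ℝ × ℝ) : ℝ := fderiv ℝ F p (0, 1)

def pe (F : ℝ × ℝ → ℝ) (p : ℝ × ℝ) : ℝ := fderiv ℝ F p (1, 0)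

lemma pt_smooth {F : ℝ × ℝ → ℝ} (hF : ContDiff ℝ (⊤ : ℕ∞) F) : ContDiff ℝ (⊤ : ℕ∞) (pt F) :=
  (hF.fderiv_right (m := (⊤ : ℕ∞)) (by simp)).clm_apply contDiff_const

lemma pe_smooth {F : ℝ × ℝ → ℝ} (hF : ContDiff ℝ (⊤ : ℕ∞) F) : ContDiff ℝ (⊤ : ℕ∞) (pe F) :=
  (hF.fderiv_right (m := (⊤ : ℕ∞)) (by simp)).clm_apply contDiff_const

lemma pt_hd {F : ℝ × ℝ → ℝ} (hF : ContDiff ℝ (⊤ : ℕ∞) F) (e t : ℝ) :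
    HasDerivAt (fun t => F (e, t)) (pt F (e, t)) t :=
  ((hF.differentiable (by simp)) (e, t)).hasFDerivAt.comp_hasDerivAt t
    ((hasDerivAt_const t e).prodMk (hasDerivAt_id t))

lemma pe_hd {F : ℝ × ℝ → ℝ} (hF : ContDiff ℝ (⊤ : ℕ∞) F) (e t : ℝ) :
    HasDerivAt (fun e => F (e, t)) (pe F (e, t)) e :=
  ((hF.differentiable (by simp)) (e, t)).hasFDerivAt.comp_hasDerivAt e
    ((hasDerivAt_id e).prodMk (hasDerivAt_const e t))

lemma pe_pt {F : ℝ × ℝ → ℝ} (hF : ContDiff ℝ (⊤ : ℕ∞) F) : pe (pt F) = pt (pe F) := by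
  have hd : Differentiable ℝ (fderiv ℝ F) :=
    (hF.fderiv_right (m := (⊤ : ℕ∞)) (by simp)).differentiable (by simp)
  funext p
  have hs : IsSymmSndFDerivAt ℝ F p := hF.contDiffAt.isSymmSndFDerivAt (by
    simp only [minSmoothness_of_isRCLikeNormedField]
    exact WithTop.coe_le_coe.2 (le_top : (2 : ℕ∞) ≤ ⊤))
  have key : ∀ v w : ℝ × ℝ, fderiv ℝ (fun q => fderiv ℝ F q v) p w
      = fderiv ℝ (fderiv ℝ F) p w v := by
    intro v w
    rw [fderiv_clm_apply (hd p) (differentiableAt_const v)]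
    simp
  change fderiv ℝ (fun q => fderiv ℝ F q (0, 1)) p (1, 0)
    = fderiv ℝ (fun q => fderiv ℝ F q (1, 0)) p (0, 1)
  rw [key, key]
  exact hs.eq _ _

/-- Derivative of the square root of a sum of squares. -/
lemma hd_w {a b : ℝ → ℝ} {a' b' t : ℝ} (ha : HasDerivAt a a' t) (hb : HasDerivAt b b' t)
    (h : 0 < a t * a t + b t * b t) :
    HasDerivAt (fun t => √(a t * a t + b t * b t))
      ((a t * a' + b t * b') / √(a t * a t + b t * b t)) t := by
  have h1 : HasDerivAt (fun t => a t * a t + b t * b t)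
      (a' * a t + a t * a' + (b' * b t + b t * b')) t := (ha.mul ha).add (hb.mul hb)
  have := h1.sqrt h.ne'
  convert this using 1
  have : √(a t * a t + b t * b t) ≠ 0 := (Real.sqrt_pos.2 h).ne'
  field_simp
  ring

/-- For a smooth variation `c(ε,θ)` of closed planar curves with
`δc = ∂_ε c`, the variation of the curvature satisfies
`∂_ε κ = D_θ²(δc · n) + κ²·(δc · n) + (D_θ κ)·(δc · τ)`. -/
theorem variation_of_curvature
    (c : ℝ → ℝ → ℝ × ℝ)
    (hc : ContDiff ℝ (⊤ : ℕ∞) (fun p : ℝ × ℝ => c p.1 p.2))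
    (hcl : ∀ ε, IsClosedCurve (c ε))
    (δc : ℝ → ℝ → ℝ × ℝ)
    (hδc : ∀ ε θ, δc ε θ = deriv (fun ε' => c ε' θ) ε) :
    ∀ ε θ,
      deriv (fun ε' => curv (c ε') θ) ε
        = Dth (c ε) (fun θ' => Dth (c ε) (fun θ'' => dotp (δc ε θ'') (nvec (c ε) θ'')) θ') θ
          + curv (c ε) θ ^ 2 * dotp (δc ε θ) (nvec (c ε) θ)
          + Dth (c ε) (curv (c ε)) θ * dotp (δc ε θ) (tang (c ε) θ) := by
  have hX : ContDiff ℝ (⊤ : ℕ∞) (fun p : ℝ × ℝ => (c p.1 p.2).1) := hc.fst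
  have hY : ContDiff ℝ (⊤ : ℕ∞) (fun p : ℝ × ℝ => (c p.1 p.2).2) := hc.snd
  set X : ℝ × ℝ → ℝ := fun p => (c p.1 p.2).1 with hXd
  set Y : ℝ × ℝ → ℝ := fun p => (c p.1 p.2).2 with hYd
  have hcθ : ∀ e t, deriv (c e) t = (pt X (e, t), pt Y (e, t)) := fun e t =>
    ((pt_hd hX e t).prodMk (pt_hd hY e t)).deriv
  have hcε : ∀ e t, δc e t = (pe X (e, t), pe Y (e, t)) := fun e t => by
    rw [hδc]
    exact ((pe_hd hX e t).prodMk (pe_hd hY e t)).deriv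
  have hpos : ∀ e t, 0 < pt X (e, t) * pt X (e, t) + pt Y (e, t) * pt Y (e, t) := by
    intro e t
    have h := (hcl e).2 t
    rw [hcθ] at h
    by_contra hn
    apply h
    have h1 : pt X (e, t) = 0 := by nlinarith [mul_self_nonneg (pt X (e, t)), mul_self_nonneg (pt Y (e, t))]
    have h2 : pt Y (e, t) = 0 := by nlinarith [mul_self_nonneg (pt X (e, t)), mul_self_nonneg (pt Y (e, t))]
    rw [h1, h2]; rfl
  have hX1 := pt_smooth hX
  have hY1 := pt_smooth hY
  have hX2 := pt_smooth hX1
  have hY2 := pt_smooth hY1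
  have hU := pe_smooth hX
  have hV := pe_smooth hY
  have hU1 := pt_smooth hU
  have hV1 := pt_smooth hV
  have eX1 : pe (pt X) = pt (pe X) := pe_pt hX
  have eY1 : pe (pt Y) = pt (pe Y) := pe_pt hY
  have eX2 : pe (pt (pt X)) = pt (pt (pe X)) := by rw [pe_pt hX1, eX1]
  have eY2 : pe (pt (pt Y)) = pt (pt (pe Y)) := by rw [pe_pt hY1, eY1]
  obtain ⟨w, hw⟩ : ∃ w : ℝ → ℝ → ℝ, ∀ e t, w e t =
      √(pt X (e, t) * pt X (e, t) + pt Y (e, t) * pt Y (e, t)) := ⟨_, fun _ _ => rfl⟩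
  have hw0 : ∀ e t, w e t ≠ 0 := fun e t => by rw [hw]; exact (Real.sqrt_pos.2 (hpos e t)).ne'
  have hwsq : ∀ e t, w e t ^ 2 = pt X (e, t) ^ 2 + pt Y (e, t) ^ 2 := fun e t => by
    rw [hw, Real.sq_sqrt (hpos e t).le]; ring
  have hwt : ∀ e t, HasDerivAt (fun t => w e t)
      ((pt X (e, t) * pt (pt X) (e, t) + pt Y (e, t) * pt (pt Y) (e, t)) / w e t) t := by
    intro e t
    simp only [hw]
    exact hd_w (pt_hd hX1 e t) (pt_hd hY1 e t) (hpos e t)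
  have hwe : ∀ e t, HasDerivAt (fun e => w e t)
      ((pt X (e, t) * pt (pe X) (e, t) + pt Y (e, t) * pt (pe Y) (e, t)) / w e t) e := by
    intro e t
    simp only [hw]
    rw [← eX1, ← eY1]
    exact hd_w (pe_hd hX1 e t) (pe_hd hY1 e t) (hpos e t)
  have hsp : ∀ e t, speed (c e) t = w e t := fun e t => by
    simp only [speed, nrm, dotp, cder, hcθ, hw]
  have htan : ∀ e, tang (c e) = fun t => (pt X (e, t) / w e t, pt Y (e, t) / w e t) := fun e => by
    funext t
    simp only [tang, cder, hcθ, hsp, Prod.smul_mk, smul_eq_mul, div_eq_inv_mul]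
  have hκ : ∀ e t, curv (c e) t =
      (pt X (e, t) * pt (pt Y) (e, t) - pt Y (e, t) * pt (pt X) (e, t)) / w e t ^ 3 := by
    intro e t
    have hd := (((pt_hd hX1 e t).div (hwt e t) (hw0 e t)).prodMk
      ((pt_hd hY1 e t).div (hwt e t) (hw0 e t))).deriv
    have hd' : deriv (tang (c e)) t = _ := (congrArg (fun f => deriv f t) (htan e)).trans hd
    have h0 := hw0 e t
    simp only [curv, DthV, nvec, Jrot, dotp, hd', hsp, Prod.smul_mk, smul_eq_mul]
    simp only [htan]
    field_simp
    ring
  -- first arclength derivative of the normal component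
  have hφ : ∀ e t, Dth (c e) (fun t => dotp (δc e t) (nvec (c e) t)) t =
      (pt (pt Y) (e, t) * -pe X (e, t) + pt Y (e, t) * -pt (pe X) (e, t)
        + (pt (pt X) (e, t) * pe Y (e, t) + pt X (e, t) * pt (pe Y) (e, t))) / w e t ^ 2
      - (pt Y (e, t) * -pe X (e, t) + pt X (e, t) * pe Y (e, t)) *
        (pt X (e, t) * pt (pt X) (e, t) + pt Y (e, t) * pt (pt Y) (e, t)) / w e t ^ 4 := by
    intro e t
    have h0 := hw0 e t
    have hf : (fun t => dotp (δc e t) (nvec (c e) t)) = fun t =>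
        (pt Y (e, t) * -pe X (e, t) + pt X (e, t) * pe Y (e, t)) / w e t := by
      funext t
      simp only [dotp, nvec, Jrot, htan, hcε]
      ring
    have hd := ((((pt_hd hY1 e t).mul (pt_hd hU e t).neg).add
      ((pt_hd hX1 e t).mul (pt_hd hV e t))).div (hwt e t) h0).deriv
    have hd' : deriv (fun t =>
        (pt Y (e, t) * -pe X (e, t) + pt X (e, t) * pe Y (e, t)) / w e t) t = _ := hd
    rw [Dth, hf, hd', hsp]
    simp only [Pi.add_apply, Pi.mul_apply, Pi.neg_apply]
    field_simp
  intro e t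
  have h0 := hw0 e t
  have hq := hwsq e t
  have hN := ((pt_hd hY1 e t).mul (pt_hd hU e t).neg).add ((pt_hd hX1 e t).mul (pt_hd hV e t))
  have hN' := (((pt_hd hY2 e t).mul (pt_hd hU e t).neg).add
      ((pt_hd hY1 e t).mul (pt_hd hU1 e t).neg)).add
    (((pt_hd hX2 e t).mul (pt_hd hV e t)).add ((pt_hd hX1 e t).mul (pt_hd hV1 e t)))
  have hS := ((pt_hd hX1 e t).mul (pt_hd hX2 e t)).add ((pt_hd hY1 e t).mul (pt_hd hY2 e t))
  have hD2 := ((hN'.div ((hwt e t).pow 2) (pow_ne_zero 2 h0)).sub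
    ((hN.mul hS).div ((hwt e t).pow 4) (pow_ne_zero 4 h0))).deriv
  have hκt := ((((pt_hd hX1 e t).mul (pt_hd hY2 e t)).sub
    ((pt_hd hY1 e t).mul (pt_hd hX2 e t))).div ((hwt e t).pow 3) (pow_ne_zero 3 h0)).deriv
  have hκe := ((((pe_hd hX1 e t).mul (pe_hd hY2 e t)).sub
    ((pe_hd hY1 e t).mul (pe_hd hX2 e t))).div ((hwe e t).pow 3) (pow_ne_zero 3 h0)).deriv
  rw [eX1, eY1, eX2, eY2] at hκe
  have hκf : curv (c e) = fun t =>
      (pt X (e, t) * pt (pt Y) (e, t) - pt Y (e, t) * pt (pt X) (e, t)) / w e t ^ 3 :=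
    funext (hκ e)
  have hκef : (fun e => curv (c e) t) = fun e =>
      (pt X (e, t) * pt (pt Y) (e, t) - pt Y (e, t) * pt (pt X) (e, t)) / w e t ^ 3 :=
    funext (fun e => hκ e t)
  have A1 : deriv (fun e => curv (c e) t) e = _ :=
    (congrArg (fun f => deriv f e) hκef).trans hκe
  have A2 : deriv (curv (c e)) t = _ := (congrArg (fun f => deriv f t) hκf).trans hκt
  have A3 : deriv (fun θ' => Dth (c e) (fun θ'' => dotp (δc e θ'') (nvec (c e) θ'')) θ') t = _ :=
    (congrArg (fun f => deriv f t) (funext (hφ e))).trans hD2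
  rw [A1, Dth, A3, Dth, A2, hκ, hsp]
  simp only [dotp, nvec, Jrot, htan, hcε, Pi.add_apply, Pi.mul_apply, Pi.neg_apply, Pi.sub_apply,
    Pi.pow_apply]
  clear A1 A2 A3 hκef hκf hκe hκt hD2 hS hN' hN
  generalize w e t = W at *
  generalize pt (pt (pt X)) (e, t) = x3 at *
  generalize pt (pt (pt Y)) (e, t) = y3 at *
  generalize pt (pt X) (e, t) = x2 at *
  generalize pt (pt Y) (e, t) = y2 at *
  generalize pt (pt (pe X)) (e, t) = u2 at *
  generalize pt (pt (pe Y)) (e, t) = v2 at *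
  generalize pt (pe X) (e, t) = u1 at *
  generalize pt (pe Y) (e, t) = v1 at *
  generalize pe X (e, t) = u at *
  generalize pe Y (e, t) = v at *
  generalize pt X (e, t) = x1 at *
  generalize pt Y (e, t) = y1 at *
  clear * - h0 hq
  have e4 : W ^ 4 = (x1 ^ 2 + y1 ^ 2) ^ 2 := by rw [← hq]; ring
  norm_num
  field_simp
  ring_nf
  simp only [hq, e4]
  ring
end
end

section
/- Let c(t,ε,θ) be a smooth map ℝ³ → ℝ² such that for each (t,ε) the map θ ↦ c(t,ε,θ) is a closed planar curve. Set h := (∂_t c) · n, s := (∂_t c) · τ and δc := ∂_ε c. Then at every (t,ε,θ) the variation of the normal velocity satisfies ∂_ε h = ∂_t(δc · n) − s · D_θ(δc · n) + (D_θ h)·(δc · τ). -/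
noncomputable section

lemma aux_pos (y : ℝ × ℝ) (h0 : y ≠ 0) : 0 < dotp y y := by
  unfold dotp
  by_contra hn
  apply h0
  ext
  · simp only [Prod.fst_zero]
    nlinarith [sq_nonneg y.1, sq_nonneg y.2]
  · simp only [Prod.snd_zero]
    nlinarith [sq_nonneg y.1, sq_nonneg y.2]

lemma aux_algebra (T E Y TE TH EH HH : ℝ × ℝ) (h0 : Y ≠ 0) :
    (nrm Y)⁻¹ * (-TE.1 * Y.2 - T.1 * EH.2 + TE.2 * Y.1 + T.2 * EH.1)
        - (nrm Y)⁻¹ ^ 3 * dotp Y EH * (-T.1 * Y.2 + T.2 * Y.1)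
      = ((nrm Y)⁻¹ * (-TE.1 * Y.2 - E.1 * TH.2 + TE.2 * Y.1 + E.2 * TH.1)
        - (nrm Y)⁻¹ ^ 3 * dotp Y TH * (-E.1 * Y.2 + E.2 * Y.1))
      - dotp T ((nrm Y)⁻¹ • Y) * ((nrm Y)⁻¹ *
        ((nrm Y)⁻¹ * (-EH.1 * Y.2 - E.1 * HH.2 + EH.2 * Y.1 + E.2 * HH.1)
        - (nrm Y)⁻¹ ^ 3 * dotp Y HH * (-E.1 * Y.2 + E.2 * Y.1)))
      + (nrm Y)⁻¹ * ((nrm Y)⁻¹ * (-TH.1 * Y.2 - T.1 * HH.2 + TH.2 * Y.1 + T.2 * HH.1)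
        - (nrm Y)⁻¹ ^ 3 * dotp Y HH * (-T.1 * Y.2 + T.2 * Y.1))
        * dotp E ((nrm Y)⁻¹ • Y) := by
  have hpos := aux_pos Y h0
  have hr : 0 < nrm Y := Real.sqrt_pos.2 hpos
  have hsq : (nrm Y)⁻¹ ^ 2 * (Y.1 * Y.1 + Y.2 * Y.2) = 1 := by
    have : nrm Y ^ 2 = Y.1 * Y.1 + Y.2 * Y.2 := Real.sq_sqrt hpos.le
    rw [← this]; field_simp
  generalize (nrm Y)⁻¹ = q at *
  obtain ⟨T1, T2⟩ := T
  obtain ⟨E1, E2⟩ := E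
  obtain ⟨y1, y2⟩ := Y
  obtain ⟨A1, A2⟩ := TE
  obtain ⟨B1, B2⟩ := TH
  obtain ⟨C1, C2⟩ := EH
  obtain ⟨D1, D2⟩ := HH
  simp only [dotp, Prod.smul_mk, smul_eq_mul] at *
  grind


lemma aux_hasDerivAt (x y : ℝ → ℝ × ℝ) (x' y' : ℝ × ℝ) (u : ℝ)
    (hx : HasDerivAt x x' u) (hy : HasDerivAt y y' u) (h0 : y u ≠ 0) :
    HasDerivAt (fun v => dotp (x v) (Jrot ((nrm (y v))⁻¹ • y v)))
      ((nrm (y u))⁻¹ * (-x'.1 * (y u).2 - (x u).1 * y'.2 + x'.2 * (y u).1 + (x u).2 * y'.1)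
        - (nrm (y u))⁻¹ ^ 3 * dotp (y u) y' * (-(x u).1 * (y u).2 + (x u).2 * (y u).1)) u := by
  have hx1 : HasDerivAt (fun v => (x v).1) x'.1 u := hx.fst
  have hx2 : HasDerivAt (fun v => (x v).2) x'.2 u := hx.snd
  have hy1 : HasDerivAt (fun v => (y v).1) y'.1 u := hy.fst
  have hy2 : HasDerivAt (fun v => (y v).2) y'.2 u := hy.snd
  have hpos : 0 < dotp (y u) (y u) := by
    unfold dotp
    by_contra hn
    apply h0
    ext
    · simp only [Prod.fst_zero]
      nlinarith [sq_nonneg (y u).1, sq_nonneg (y u).2]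
    · simp only [Prod.snd_zero]
      nlinarith [sq_nonneg (y u).1, sq_nonneg (y u).2]
  have hr : 0 < nrm (y u) := Real.sqrt_pos.2 hpos
  have hd : HasDerivAt (fun v => dotp (y v) (y v)) (2 * dotp (y u) y') u := by
    have := (hy1.mul hy1).add (hy2.mul hy2)
    refine HasDerivAt.congr_deriv this ?_
    unfold dotp; ring
  have hn : HasDerivAt (fun v => nrm (y v)) (2 * dotp (y u) y' / (2 * nrm (y u))) u :=
    hd.sqrt hpos.ne'
  have hi : HasDerivAt (fun v => (nrm (y v))⁻¹) _ u := hn.fun_inv hr.ne'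
  have hm := ((hx2.fun_mul hy1).fun_sub (hx1.fun_mul hy2))
  have hf := hi.fun_mul hm
  have e : (fun v => dotp (x v) (Jrot ((nrm (y v))⁻¹ • y v)))
      = fun v => (nrm (y v))⁻¹ * ((x v).2 * (y v).1 - (x v).1 * (y v).2) := by
    funext v
    simp only [dotp, Jrot, Prod.smul_fst, Prod.smul_snd, smul_eq_mul]
    ring
  rw [e]
  refine hf.congr_deriv ?_
  field_simp
  ring

/-- For a smooth family `c(t,ε,θ)` of closed planar curves with
`h = (∂_t c)·n`, `s = (∂_t c)·τ` and `δc = ∂_ε c`, the variation of the normal velocity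
satisfies `∂_ε h = ∂_t(δc · n) − s·D_θ(δc · n) + (D_θ h)·(δc · τ)`. -/
theorem variation_of_normal_velocity
    (c : ℝ → ℝ → ℝ → ℝ × ℝ)
    (hc : ContDiff ℝ (⊤ : ℕ∞) (fun p : ℝ × ℝ × ℝ => c p.1 p.2.1 p.2.2))
    (hcl : ∀ t ε, IsClosedCurve (c t ε))
    (h s : ℝ → ℝ → ℝ → ℝ) (δc : ℝ → ℝ → ℝ → ℝ × ℝ)
    (hh : ∀ t ε θ, h t ε θ = dotp (deriv (fun t' => c t' ε θ) t) (nvec (c t ε) θ))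
    (hs : ∀ t ε θ, s t ε θ = dotp (deriv (fun t' => c t' ε θ) t) (tang (c t ε) θ))
    (hδc : ∀ t ε θ, δc t ε θ = deriv (fun ε' => c t ε' θ) ε) :
    ∀ t ε θ,
      deriv (fun ε' => h t ε' θ) ε
        = deriv (fun t' => dotp (δc t' ε θ) (nvec (c t' ε) θ)) t
          - s t ε θ * Dth (c t ε) (fun θ' => dotp (δc t ε θ') (nvec (c t ε) θ')) θ
          + Dth (c t ε) (h t ε) θ * dotp (δc t ε θ) (tang (c t ε) θ) := by
  intro t ε θ
  set F : ℝ × ℝ × ℝ → ℝ × ℝ := fun p => c p.1 p.2.1 p.2.2 with hF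
  have hFd : Differentiable ℝ F := hc.differentiable (by simp)
  have hF1 : ContDiff ℝ 1 (fderiv ℝ F) := hc.fderiv_right (by norm_cast)
  have hF1d : Differentiable ℝ (fderiv ℝ F) := hF1.differentiable (by simp)
  have pt : ∀ a b d : ℝ, HasDerivAt (fun u : ℝ => ((u, b, d) : ℝ × ℝ × ℝ)) (1, 0, 0) a :=
    fun a b d => (hasDerivAt_id a).prodMk ((hasDerivAt_const a b).prodMk (hasDerivAt_const a d))
  have pe : ∀ a b d : ℝ, HasDerivAt (fun u : ℝ => ((a, u, d) : ℝ × ℝ × ℝ)) (0, 1, 0) b :=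
    fun a b d => (hasDerivAt_const b a).prodMk ((hasDerivAt_id b).prodMk (hasDerivAt_const b d))
  have pth : ∀ a b d : ℝ, HasDerivAt (fun u : ℝ => ((a, b, u) : ℝ × ℝ × ℝ)) (0, 0, 1) d :=
    fun a b d => (hasDerivAt_const d a).prodMk ((hasDerivAt_const d b).prodMk (hasDerivAt_id d))
  have dt : ∀ a b d, deriv (fun u => c u b d) a = fderiv ℝ F (a, b, d) (1, 0, 0) := fun a b d =>
    (HasFDerivAt.comp_hasDerivAt (l := F) a (hFd (a, b, d)).hasFDerivAt (pt a b d)).deriv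
  have de : ∀ a b d, deriv (fun u => c a u d) b = fderiv ℝ F (a, b, d) (0, 1, 0) := fun a b d =>
    (HasFDerivAt.comp_hasDerivAt (l := F) b (hFd (a, b, d)).hasFDerivAt (pe a b d)).deriv
  have dth : ∀ a b d, deriv (c a b) d = fderiv ℝ F (a, b, d) (0, 0, 1) := fun a b d =>
    (HasFDerivAt.comp_hasDerivAt (l := F) d (hFd (a, b, d)).hasFDerivAt (pth a b d)).deriv
  have hne : ∀ a b d, fderiv ℝ F (a, b, d) (0, 0, 1) ≠ 0 := fun a b d => by
    rw [← dth]; exact (hcl a b).2 d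
  have hsym : ∀ v w, fderiv ℝ (fderiv ℝ F) (t, ε, θ) v w = fderiv ℝ (fderiv ℝ F) (t, ε, θ) w v := by
    intro v w
    have : IsSymmSndFDerivAt ℝ F (t, ε, θ) :=
      hc.contDiffAt.isSymmSndFDerivAt (by simp; norm_cast)
    exact this v w
  have d2 : ∀ (g : ℝ → ℝ × ℝ × ℝ) (w : ℝ × ℝ × ℝ) (u : ℝ), HasDerivAt g w u → ∀ v,
      HasDerivAt (fun u => fderiv ℝ F (g u) v) (fderiv ℝ (fderiv ℝ F) (g u) w v) u := by
    intro g w u hg v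
    have h1 := (hF1d (g u)).hasFDerivAt.comp_hasDerivAt u hg
    have h2 := h1.clm_apply (hasDerivAt_const u v)
    simpa using h2
  have ht : h = fun a b d => dotp (fderiv ℝ F (a, b, d) (1, 0, 0))
      (Jrot ((nrm (fderiv ℝ F (a, b, d) (0, 0, 1)))⁻¹ • fderiv ℝ F (a, b, d) (0, 0, 1))) := by
    funext a b d
    rw [hh, dt]; simp only [nvec, tang, speed, cder, dth]
  simp only [hs, hδc, ht, Dth, nvec, tang, speed, cder, dt, de, dth]
  rw [(aux_hasDerivAt _ _ _ _ _ (d2 _ _ _ (pe t ε θ) (1, 0, 0)) (d2 _ _ _ (pe t ε θ) (0, 0, 1))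
      (hne t ε θ)).deriv,
    (aux_hasDerivAt _ _ _ _ _ (d2 _ _ _ (pt t ε θ) (0, 1, 0)) (d2 _ _ _ (pt t ε θ) (0, 0, 1))
      (hne t ε θ)).deriv,
    (aux_hasDerivAt _ _ _ _ _ (d2 _ _ _ (pth t ε θ) (0, 1, 0)) (d2 _ _ _ (pth t ε θ) (0, 0, 1))
      (hne t ε θ)).deriv,
    (aux_hasDerivAt _ _ _ _ _ (d2 _ _ _ (pth t ε θ) (1, 0, 0)) (d2 _ _ _ (pth t ε θ) (0, 0, 1))
      (hne t ε θ)).deriv]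
  rw [hsym (0, 1, 0) (1, 0, 0), hsym (0, 0, 1) (1, 0, 0), hsym (0, 0, 1) (0, 1, 0)]
  have h0 := hne t ε θ
  generalize fderiv ℝ (fderiv ℝ F) (t, ε, θ) (1, 0, 0) (0, 1, 0) = TE
  generalize fderiv ℝ (fderiv ℝ F) (t, ε, θ) (1, 0, 0) (0, 0, 1) = TH
  generalize fderiv ℝ (fderiv ℝ F) (t, ε, θ) (0, 1, 0) (0, 0, 1) = EH
  generalize fderiv ℝ (fderiv ℝ F) (t, ε, θ) (0, 0, 1) (0, 0, 1) = HH
  generalize fderiv ℝ F (t, ε, θ) (1, 0, 0) = T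
  generalize fderiv ℝ F (t, ε, θ) (0, 1, 0) = E
  generalize fderiv ℝ F (t, ε, θ) (0, 0, 1) = Y at h0 ⊢
  exact aux_algebra T E Y TE TH EH HH h0
end
end

section
/- Let c(t,θ) be a smooth time-dependent closed planar curve, i.e. a smooth map ℝ² → ℝ² such that each c(t,·) is a closed planar curve, and set h := (∂_t c) · n, s := (∂_t c) · τ. Then the curvature evolves according to the kinematic identity ∂_t κ − s · D_θ κ = D_θ² h + κ² · h at every (t,θ). -/
noncomputable section

/-- Joint smoothness of a scalar function of `(t,θ)`. -/
def Smo (f : ℝ → ℝ → ℝ) : Prop := ContDiff ℝ (⊤ : ℕ∞) (fun p : ℝ × ℝ => f p.1 p.2)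

/-- θ-partial derivative. -/
def pθ (f : ℝ → ℝ → ℝ) (t θ : ℝ) : ℝ := fderiv ℝ (fun p : ℝ × ℝ => f p.1 p.2) (t, θ) (0, 1)

/-- t-partial derivative. -/
def pT (f : ℝ → ℝ → ℝ) (t θ : ℝ) : ℝ := fderiv ℝ (fun p : ℝ × ℝ => f p.1 p.2) (t, θ) (1, 0)

lemma Smo.fd {f : ℝ → ℝ → ℝ} (hf : Smo f) :
    ContDiff ℝ (⊤ : ℕ∞) (fderiv ℝ (fun p : ℝ × ℝ => f p.1 p.2)) :=
  ContDiff.fderiv_right hf (by exact_mod_cast le_refl _)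

lemma Smo.pθ {f : ℝ → ℝ → ℝ} (hf : Smo f) : Smo (pθ f) :=
  (hf.fd).clm_apply contDiff_const

lemma Smo.pT {f : ℝ → ℝ → ℝ} (hf : Smo f) : Smo (pT f) :=
  (hf.fd).clm_apply contDiff_const

lemma Smo.da {f : ℝ → ℝ → ℝ} (hf : Smo f) (p : ℝ × ℝ) :
    HasFDerivAt (fun p : ℝ × ℝ => f p.1 p.2) (fderiv ℝ (fun p : ℝ × ℝ => f p.1 p.2) p) p :=
  (ContDiff.differentiable hf (by simp) p).hasFDerivAt

lemma Smo.hθ {f : ℝ → ℝ → ℝ} (hf : Smo f) (t θ : ℝ) :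
    HasDerivAt (fun θ' => f t θ') (_root_.pθ f t θ) θ :=
  (hf.da (t, θ)).comp_hasDerivAt θ ((hasDerivAt_const θ t).prodMk (hasDerivAt_id θ))

lemma Smo.hT {f : ℝ → ℝ → ℝ} (hf : Smo f) (t θ : ℝ) :
    HasDerivAt (fun t' => f t' θ) (_root_.pT f t θ) t :=
  HasFDerivAt.comp_hasDerivAt (f := fun t' : ℝ => ((t', θ) : ℝ × ℝ)) t (hf.da (t, θ))
    ((hasDerivAt_id t).prodMk (hasDerivAt_const t θ))

lemma Smo.comm {f : ℝ → ℝ → ℝ} (hf : Smo f) : _root_.pT (_root_.pθ f) = _root_.pθ (_root_.pT f) := by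
  have hd : Differentiable ℝ (fderiv ℝ (fun p : ℝ × ℝ => f p.1 p.2)) :=
    hf.fd.differentiable (by simp)
  have key : ∀ p v w : ℝ × ℝ,
      fderiv ℝ (fun q : ℝ × ℝ => fderiv ℝ (fun p : ℝ × ℝ => f p.1 p.2) q v) p w
        = fderiv ℝ (fderiv ℝ (fun p : ℝ × ℝ => f p.1 p.2)) p w v := by
    intro p v w
    rw [fderiv_clm_apply (hd p) (differentiableAt_const v)]
    simp
  funext t θ
  have sy : IsSymmSndFDerivAt ℝ (fun p : ℝ × ℝ => f p.1 p.2) (t, θ) :=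
    ContDiffAt.isSymmSndFDerivAt (n := (⊤ : ℕ∞)) (ContDiff.contDiffAt hf) (by
      rw [minSmoothness_of_isRCLikeNormedField]; exact WithTop.coe_le_coe.2 (le_top : (2 : ℕ∞) ≤ ⊤))
  have e1 := key (t, θ) (0, 1) (1, 0)
  have e2 := key (t, θ) (1, 0) (0, 1)
  exact e1.trans ((sy _ _).trans e2.symm)

/-- speed as a function of the components -/
def spd (a b : ℝ) : ℝ := Real.sqrt (a * a + b * b)

lemma spd_sq (a b : ℝ) : spd a b ^ 2 = a ^ 2 + b ^ 2 := by
  unfold spd; rw [Real.sq_sqrt (by nlinarith [mul_self_nonneg a, mul_self_nonneg b])]; ring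

lemma spd_pos {a b : ℝ} (h : (a, b) ≠ (0 : ℝ × ℝ)) : 0 < spd a b := by
  unfold spd
  apply Real.sqrt_pos.2
  by_contra hn
  apply h
  have ha : a = 0 := by nlinarith [mul_self_nonneg a, mul_self_nonneg b]
  have hb : b = 0 := by nlinarith [mul_self_nonneg a, mul_self_nonneg b]
  simp [ha, hb]

lemma spd_deriv {a b : ℝ → ℝ} {a' b' x : ℝ} (ha : HasDerivAt a a' x) (hb : HasDerivAt b b' x)
    (hp : 0 < spd (a x) (b x)) :
    HasDerivAt (fun y => spd (a y) (b y)) ((a x * a' + b x * b') / spd (a x) (b x)) x := by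
  have h0 : a x * a x + b x * b x ≠ 0 := by
    intro h; simp [spd, h] at hp
  have := ((ha.mul ha).add (hb.mul hb)).sqrt h0
  refine this.congr_deriv ?_
  change _ / (2 * spd (a x) (b x)) = _
  field_simp
  ring

/-- For a smooth time-dependent closed planar curve `c(t,θ)` with
`h = (∂_t c)·n` and `s = (∂_t c)·τ`, the curvature evolves according to the kinematic
identity `∂_t κ − s·D_θ κ = D_θ² h + κ²·h`. -/
theorem curvature_kinematic_identity
    (c : ℝ → ℝ → ℝ × ℝ)
    (hc : ContDiff ℝ (⊤ : ℕ∞) (fun p : ℝ × ℝ => c p.1 p.2))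
    (hcl : ∀ t, IsClosedCurve (c t))
    (h s : ℝ → ℝ → ℝ)
    (hh : ∀ t θ, h t θ = dotp (deriv (fun t' => c t' θ) t) (nvec (c t) θ))
    (hs : ∀ t θ, s t θ = dotp (deriv (fun t' => c t' θ) t) (tang (c t) θ)) :
    ∀ t θ,
      deriv (fun t' => curv (c t') θ) t - s t θ * Dth (c t) (curv (c t)) θ
        = Dth (c t) (fun θ' => Dth (c t) (h t) θ') θ + curv (c t) θ ^ 2 * h t θ := by
  obtain ⟨u, hu⟩ : ∃ u : ℝ → ℝ → ℝ, u = fun t θ => (c t θ).1 := ⟨_, rfl⟩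
  obtain ⟨v, hv⟩ : ∃ v : ℝ → ℝ → ℝ, v = fun t θ => (c t θ).2 := ⟨_, rfl⟩
  have su : Smo u := by rw [hu]; exact contDiff_fst.comp hc
  have sv : Smo v := by rw [hv]; exact contDiff_snd.comp hc
  have hcuv : ∀ t θ, c t θ = (u t θ, v t θ) := by intro t θ; simp [hu, hv]
  have hct : ∀ t θ, deriv (fun t' => c t' θ) t = (pT u t θ, pT v t θ) := by
    intro t θ
    have := ((su.hT t θ).prodMk (sv.hT t θ)).deriv
    simpa only [← hcuv] using this
  have hcθ : ∀ t θ, deriv (c t) θ = (pθ u t θ, pθ v t θ) := by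
    intro t θ
    have := ((su.hθ t θ).prodMk (sv.hθ t θ)).deriv
    simpa only [← hcuv] using this
  clear hu hv
  have com1 := su.comm
  have com2 := sv.comm
  have com3 := su.pθ.comm
  have com4 := sv.pθ.comm
  have sx1 := su.pθ
  have sy1 := sv.pθ
  have sx2 := sx1.pθ
  have sy2 := sy1.pθ
  have sa0 := su.pT
  have sb0 := sv.pT
  have sa1 := sa0.pθ
  have sb1 := sb0.pθ
  rw [com1] at com3
  rw [com2] at com4
  obtain ⟨x1, hx1⟩ : ∃ x, x = pθ u := ⟨_, rfl⟩
  obtain ⟨y1, hy1⟩ : ∃ x, x = pθ v := ⟨_, rfl⟩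
  obtain ⟨a0, ha0⟩ : ∃ x, x = pT u := ⟨_, rfl⟩
  obtain ⟨b0, hb0⟩ : ∃ x, x = pT v := ⟨_, rfl⟩
  rw [← hx1, ← ha0] at com1
  rw [← hy1, ← hb0] at com2
  rw [← hx1, ← ha0] at com3
  rw [← hy1, ← hb0] at com4
  simp only [← hx1, ← hy1, ← ha0, ← hb0] at *
  have hpos : ∀ t θ, 0 < spd (x1 t θ) (y1 t θ) := by
    intro t θ
    apply spd_pos
    rw [← hcθ]
    exact (hcl t).2 θ
  have hspeed : ∀ t θ, speed (c t) θ = spd (x1 t θ) (y1 t θ) := by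
    intro t θ; simp [speed, nrm, cder, dotp, hcθ, spd]
  have htang : ∀ t, tang (c t) = fun θ => ((spd (x1 t θ) (y1 t θ))⁻¹ * x1 t θ,
      (spd (x1 t θ) (y1 t θ))⁻¹ * y1 t θ) := by
    intro t; funext θ; simp [tang, cder, hcθ, hspeed]
  have hgθ : ∀ t θ, HasDerivAt (fun θ' => spd (x1 t θ') (y1 t θ')) _ θ := fun t θ =>
    spd_deriv (sx1.hθ t θ) (sy1.hθ t θ) (hpos t θ)
  have hgT : ∀ t θ, HasDerivAt (fun t' => spd (x1 t' θ) (y1 t' θ)) _ t := fun t θ =>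
    spd_deriv (sx1.hT t θ) (sy1.hT t θ) (hpos t θ)
  have hcurv : ∀ t θ, curv (c t) θ =
      (x1 t θ * pθ y1 t θ - y1 t θ * pθ x1 t θ) / spd (x1 t θ) (y1 t θ) ^ 3 := by
    intro t θ
    have hp := hpos t θ
    have hi := (hgθ t θ).inv hp.ne'
    have := ((hi.mul (sx1.hθ t θ)).prodMk (hi.mul (sy1.hθ t θ))).deriv
    have e := (congrArg (fun f => deriv f θ) (htang t)).trans this
    beta_reduce at e
    simp only [curv, DthV, nvec, e]
    simp only [htang, hspeed, dotp, Jrot, Prod.smul_mk, smul_eq_mul,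
      Pi.inv_apply]
    generalize spd (x1 t θ) (y1 t θ) = g at *
    field_simp
    ring
  have hh' : ∀ t θ, h t θ = (b0 t θ * x1 t θ - a0 t θ * y1 t θ) / spd (x1 t θ) (y1 t θ) := by
    intro t θ
    have hp := hpos t θ
    simp only [hh, hct, nvec, htang, Jrot, dotp]
    field_simp
    ring
  have hs' : ∀ t θ, s t θ = (a0 t θ * x1 t θ + b0 t θ * y1 t θ) / spd (x1 t θ) (y1 t θ) := by
    intro t θ
    have hp := hpos t θ
    simp only [hs, hct, htang, dotp]
    field_simp
  have hDh : ∀ t θ, Dth (c t) (h t) θ =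
      (pθ b0 t θ * x1 t θ + b0 t θ * pθ x1 t θ - pθ a0 t θ * y1 t θ - a0 t θ * pθ y1 t θ)
        / spd (x1 t θ) (y1 t θ) ^ 2
      - (b0 t θ * x1 t θ - a0 t θ * y1 t θ) * (x1 t θ * pθ x1 t θ + y1 t θ * pθ y1 t θ)
        / spd (x1 t θ) (y1 t θ) ^ 4 := by
    intro t θ
    have hp := hpos t θ
    have := ((((sb0.hθ t θ).mul (sx1.hθ t θ)).sub ((sa0.hθ t θ).mul (sy1.hθ t θ))).div
      (hgθ t θ) hp.ne').deriv
    have e := (congrArg (fun f => deriv f θ) (funext (hh' t))).trans this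
    beta_reduce at e
    simp only [Dth, e, hspeed, Pi.mul_apply, Pi.sub_apply]
    generalize spd (x1 t θ) (y1 t θ) = g at *
    field_simp
    ring
  intro t θ
  have hp := hpos t θ
  have e1 := (congrArg (fun f => deriv f t) (funext (fun t' => hcurv t' θ))).trans
    ((((sx1.hT t θ).mul (sy2.hT t θ)).sub ((sy1.hT t θ).mul (sx2.hT t θ))).div
      ((hgT t θ).pow 3) (pow_ne_zero 3 hp.ne')).deriv
  have e2 := (congrArg (fun f => deriv f θ) (funext (hcurv t))).trans
    ((((sx1.hθ t θ).mul (sy2.hθ t θ)).sub ((sy1.hθ t θ).mul (sx2.hθ t θ))).div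
      ((hgθ t θ).pow 3) (pow_ne_zero 3 hp.ne')).deriv
  have e3 := (congrArg (fun f => deriv f θ) (funext (hDh t))).trans
    ((((((((sb1.hθ t θ).mul (sx1.hθ t θ)).add ((sb0.hθ t θ).mul (sx2.hθ t θ))).sub
      ((sa1.hθ t θ).mul (sy1.hθ t θ))).sub ((sa0.hθ t θ).mul (sy2.hθ t θ)))).div
      ((hgθ t θ).pow 2) (pow_ne_zero 2 hp.ne')).sub
      (((((sb0.hθ t θ).mul (sx1.hθ t θ)).sub ((sa0.hθ t θ).mul (sy1.hθ t θ))).mul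
        (((sx1.hθ t θ).mul (sx2.hθ t θ)).add ((sy1.hθ t θ).mul (sy2.hθ t θ)))).div
      ((hgθ t θ).pow 4) (pow_ne_zero 4 hp.ne'))).deriv
  beta_reduce at e1 e2 e3
  rw [e1, Dth, e2, Dth, e3, hcurv, hh', hs', hspeed]
  simp only [com1, com2, com3, com4, Pi.mul_apply, Pi.sub_apply, Pi.add_apply, Pi.pow_apply]
  have hq := spd_sq (x1 t θ) (y1 t θ)
  clear e1 e2 e3
  generalize spd (x1 t θ) (y1 t θ) = g at *
  generalize pθ (pθ x1) t θ = X3 at *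
  generalize pθ (pθ y1) t θ = Y3 at *
  generalize pθ (pθ a0) t θ = A2 at *
  generalize pθ (pθ b0) t θ = B2 at *
  generalize pθ x1 t θ = X2 at *
  generalize pθ y1 t θ = Y2 at *
  generalize pθ a0 t θ = A1 at *
  generalize pθ b0 t θ = B1 at *
  generalize x1 t θ = X at *
  generalize y1 t θ = Y at *
  generalize a0 t θ = A at *
  generalize b0 t θ = B at *
  clear hh hs hh' hs' hDh hcurv hgT hgθ htang hspeed hpos
  norm_num
  field_simp
  rw [hq]
  ring
end
end

section
/- Let c(ε,θ) be a smooth variation of closed planar curves such that each curve c(ε,·) is uniformly parametrized, i.e. |c_θ(ε,θ)| = ∫₀¹ |c_θ(ε,θ')| dθ' for all ε and θ. Then with δc := ∂_ε c, at every (ε,θ) one has |c_θ| · (D_θ(δc · τ) − (δc · n)·κ) = −∫₀¹ (δc · n)(ε,θ') · κ(ε,θ') · |c_θ(ε,θ')| dθ'. -/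
noncomputable section

lemma aux_hasDerivAt_snd (g : ℝ × ℝ → ℝ × ℝ) (hg : Differentiable ℝ g) (ε θ : ℝ) :
    HasDerivAt (fun t => g (ε, t)) (fderiv ℝ g (ε, θ) (0, 1)) θ := by
  have h1 : HasDerivAt (fun t : ℝ => (ε, t)) ((0 : ℝ), (1 : ℝ)) θ :=
    (hasDerivAt_const θ ε).prodMk (hasDerivAt_id θ)
  exact (hg (ε, θ)).hasFDerivAt.comp_hasDerivAt θ h1

lemma aux_hasDerivAt_fst (g : ℝ × ℝ → ℝ × ℝ) (hg : Differentiable ℝ g) (ε θ : ℝ) :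
    HasDerivAt (fun t => g (t, θ)) (fderiv ℝ g (ε, θ) (1, 0)) ε := by
  have h1 : HasDerivAt (fun t : ℝ => (t, θ)) ((1 : ℝ), (0 : ℝ)) ε :=
    (hasDerivAt_id ε).prodMk (hasDerivAt_const ε θ)
  exact (hg (ε, θ)).hasFDerivAt.comp_hasDerivAt ε h1

lemma aux_dotp {f g : ℝ → ℝ × ℝ} {f' g' : ℝ × ℝ} {t : ℝ} (hf : HasDerivAt f f' t)
    (hg : HasDerivAt g g' t) :
    HasDerivAt (fun s => dotp (f s) (g s)) (dotp f' (g t) + dotp (f t) g') t := by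
  have f1 : HasDerivAt (fun s => (f s).1) f'.1 t :=
    (ContinuousLinearMap.fst ℝ ℝ ℝ).hasFDerivAt.comp_hasDerivAt t hf
  have f2 : HasDerivAt (fun s => (f s).2) f'.2 t :=
    (ContinuousLinearMap.snd ℝ ℝ ℝ).hasFDerivAt.comp_hasDerivAt t hf
  have g1 : HasDerivAt (fun s => (g s).1) g'.1 t :=
    (ContinuousLinearMap.fst ℝ ℝ ℝ).hasFDerivAt.comp_hasDerivAt t hg
  have g2 : HasDerivAt (fun s => (g s).2) g'.2 t :=
    (ContinuousLinearMap.snd ℝ ℝ ℝ).hasFDerivAt.comp_hasDerivAt t hg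
  have := (f1.mul g1).add (f2.mul g2)
  refine (this.congr_deriv ?_)
  simp only [dotp]
  ring

lemma aux_mixed (f : ℝ × ℝ → ℝ × ℝ) (hf : ContDiff ℝ (⊤ : ℕ∞) f) (p a b : ℝ × ℝ) :
    fderiv ℝ (fun q => fderiv ℝ f q a) p b = fderiv ℝ (fun q => fderiv ℝ f q b) p a := by
  have hd : Differentiable ℝ (fderiv ℝ f) :=
    (hf.fderiv_right (m := 1) (by norm_cast)).differentiable (by norm_num)
  have hs : IsSymmSndFDerivAt ℝ f p :=
    hf.contDiffAt.isSymmSndFDerivAt (by simp; norm_cast)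
  rw [fderiv_clm_apply (hd p) (by fun_prop), fderiv_clm_apply (hd p) (by fun_prop)]
  simpa using hs b a

/-- For a smooth variation `c(ε,θ)` of closed planar curves, each of which
is uniformly parametrized (`|c_θ(ε,θ)| = ∫₀¹ |c_θ(ε,θ')| dθ'`), one has, with `δc = ∂_ε c`,
`|c_θ| · (D_θ(δc·τ) − (δc·n)·κ) = −∫₀¹ (δc·n)·κ·|c_θ| dθ'`. -/
theorem uniform_parametrization_variation_constraint
    (c : ℝ → ℝ → ℝ × ℝ)
    (hc : ContDiff ℝ (⊤ : ℕ∞) (fun p : ℝ × ℝ => c p.1 p.2))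
    (hcl : ∀ ε, IsClosedCurve (c ε))
    (hunif : ∀ ε θ, speed (c ε) θ = ∫ θ' in (0:ℝ)..1, speed (c ε) θ')
    (δc : ℝ → ℝ → ℝ × ℝ)
    (hδc : ∀ ε θ, δc ε θ = deriv (fun ε' => c ε' θ) ε) :
    ∀ ε θ,
      speed (c ε) θ * (Dth (c ε) (fun θ' => dotp (δc ε θ') (tang (c ε) θ')) θ
          - dotp (δc ε θ) (nvec (c ε) θ) * curv (c ε) θ)
        = -∫ θ' in (0:ℝ)..1,
            dotp (δc ε θ') (nvec (c ε) θ') * curv (c ε) θ' * speed (c ε) θ' := by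
  set f : ℝ × ℝ → ℝ × ℝ := fun p => c p.1 p.2 with hf
  set u : ℝ × ℝ → ℝ × ℝ := fun p => fderiv ℝ f p (0, 1) with hu
  set v : ℝ × ℝ → ℝ × ℝ := fun p => fderiv ℝ f p (1, 0) with hv
  have hfd : Differentiable ℝ f := hc.differentiable (by simp)
  have hf1 : ContDiff ℝ (⊤ : ℕ∞) (fderiv ℝ f) := hc.fderiv_right (by norm_cast)
  have huC : ContDiff ℝ (⊤ : ℕ∞) u := hf1.clm_apply contDiff_const
  have hvC : ContDiff ℝ (⊤ : ℕ∞) v := hf1.clm_apply contDiff_const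
  have hud : Differentiable ℝ u := huC.differentiable (by simp)
  have hvd : Differentiable ℝ v := hvC.differentiable (by simp)
  have hcder : ∀ e t, cder (c e) t = u (e, t) := fun e t =>
    (aux_hasDerivAt_snd f hfd e t).deriv
  have hdv : ∀ e t, δc e t = v (e, t) := fun e t => by
    rw [hδc]; exact (aux_hasDerivAt_fst f hfd e t).deriv
  have hmix : ∀ p, fderiv ℝ u p (1, 0) = fderiv ℝ v p (0, 1) := fun p =>
    aux_mixed f hc p (0, 1) (1, 0)
  have hsp0 : ∀ e t, speed (c e) t = speed (c e) 0 := fun e t => by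
    rw [hunif e t, ← hunif e 0]
  have hnn : ∀ x : ℝ × ℝ, 0 ≤ dotp x x := fun x =>
    add_nonneg (mul_self_nonneg _) (mul_self_nonneg _)
  have hsq : ∀ e t, dotp (u (e, t)) (u (e, t)) = speed (c e) 0 ^ 2 := fun e t => by
    rw [← hsp0 e t, speed, nrm, Real.sq_sqrt (hnn _), hcder]
  intro ε θ
  set L := speed (c ε) 0 with hL
  have hLs : ∀ t, speed (c ε) t = L := hsp0 ε
  have hL0 : L ≠ 0 := by
    intro h0
    have h1 := hsq ε 0
    rw [← hL, h0] at h1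
    apply (hcl ε).2 0
    have h2 : deriv (c ε) 0 = u (ε, 0) := hcder ε 0
    rw [h2]
    simp only [dotp] at h1
    apply Prod.ext <;> simp only [Prod.fst_zero, Prod.snd_zero] <;> nlinarith
  have huD := fun t => aux_hasDerivAt_snd u hud ε t
  have hvD := fun t => aux_hasDerivAt_snd v hvd ε t
  set ut : ℝ → ℝ × ℝ := fun t => fderiv ℝ u (ε, t) (0, 1) with hut
  set vt : ℝ → ℝ × ℝ := fun t => fderiv ℝ v (ε, t) (0, 1) with hvt
  have hutc : Continuous ut := by
    have h := (huC.continuous_fderiv (by simp)).comp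
      (f := fun t : ℝ => (ε, t)) (by fun_prop)
    exact h.clm_apply continuous_const
  have hvtc : Continuous vt := by
    have h := (hvC.continuous_fderiv (by simp)).comp
      (f := fun t : ℝ => (ε, t)) (by fun_prop)
    exact h.clm_apply continuous_const
  have huc : Continuous fun t => u (ε, t) := huC.continuous.comp (by fun_prop)
  have hvc : Continuous fun t => v (ε, t) := hvC.continuous.comp (by fun_prop)
  -- orthogonality
  have horth : ∀ t, dotp (ut t) (u (ε, t)) = 0 := fun t => by
    have h := aux_dotp (huD t) (huD t)
    have h2 : (fun s => dotp (u (ε, s)) (u (ε, s))) = fun _ => L ^ 2 :=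
      funext fun s => hsq ε s
    rw [h2] at h
    have h3 := h.unique (hasDerivAt_const t _)
    simp only [dotp, hut] at h3 ⊢
    linarith
  -- the variation of the speed does not depend on the parameter
  have hconst : ∀ t, dotp (vt t) (u (ε, t)) = dotp (vt θ) (u (ε, θ)) := fun t => by
    have key : ∀ s, HasDerivAt (fun e => speed (c e) 0 ^ 2) (2 * dotp (vt s) (u (ε, s))) ε := by
      intro s
      have h0 := aux_hasDerivAt_fst u hud ε s
      have h := aux_dotp h0 h0
      have h2 : (fun e => dotp (u (e, s)) (u (e, s))) = fun e => speed (c e) 0 ^ 2 :=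
        funext fun e => hsq e s
      rw [h2] at h
      refine h.congr_deriv ?_
      rw [hmix]
      simp only [dotp, hvt]
      ring
    have := (key t).unique (key θ)
    linarith
  have htang : tang (c ε) = fun t => L⁻¹ • u (ε, t) := funext fun t => by
    rw [tang, hLs, hcder]
  have hg : ∀ t, HasDerivAt (fun t => dotp (δc ε t) (tang (c ε) t))
      (L⁻¹ * (dotp (vt t) (u (ε, t)) + dotp (v (ε, t)) (ut t))) t := fun t => by
    have h := aux_dotp (hvD t) ((huD t).const_smul L⁻¹)
    have h2 : (fun t => dotp (δc ε t) (tang (c ε) t))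
        = fun s => dotp (v (ε, s)) (L⁻¹ • u (ε, s)) := funext fun s => by rw [hdv, htang]
    rw [h2]
    refine h.congr_deriv ?_
    simp only [dotp, hvt, hut, Pi.smul_apply, Prod.smul_fst, Prod.smul_snd, smul_eq_mul]
    ring
  have hk : ∀ t, dotp (δc ε t) (nvec (c ε) t) * curv (c ε) t
      = L⁻¹ * L⁻¹ * dotp (v (ε, t)) (ut t) := fun t => by
    have hd : deriv (tang (c ε)) t = L⁻¹ • ut t := by
      rw [htang]; exact ((huD t).const_smul L⁻¹).deriv
    rw [curv, DthV, hd, nvec, hLs, hdv, htang]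
    have h1 := horth t
    have h2 : dotp (u (ε, t)) (u (ε, t)) = L ^ 2 := hsq ε t
    simp only [dotp, Jrot, Prod.smul_fst, Prod.smul_snd, smul_eq_mul] at h1 h2 ⊢
    generalize ut t = a at *
    generalize u (ε, t) = b at *
    generalize v (ε, t) = w at *
    field_simp
    linear_combination (w.1 * a.1 + w.2 * a.2) * h2 - (w.1 * b.1 + w.2 * b.2) * h1
  have hcurvint : (∫ t in (0:ℝ)..1,
      dotp (δc ε t) (nvec (c ε) t) * curv (c ε) t * speed (c ε) t)
      = - (L⁻¹ * dotp (vt θ) (u (ε, θ))) := by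
    have h1 : ∀ t, dotp (δc ε t) (nvec (c ε) t) * curv (c ε) t * speed (c ε) t
        = L⁻¹ * (dotp (vt t) (u (ε, t)) + dotp (v (ε, t)) (ut t))
          - L⁻¹ * dotp (vt θ) (u (ε, θ)) := fun t => by
      rw [hk, hLs, hconst t]
      field_simp
      ring
    have hcont : Continuous fun t =>
        L⁻¹ * (dotp (vt t) (u (ε, t)) + dotp (v (ε, t)) (ut t)) := by
      simp only [dotp]
      fun_prop
    simp_rw [h1]
    rw [intervalIntegral.integral_sub (hcont.intervalIntegrable _ _) (by simp),
      intervalIntegral.integral_eq_sub_of_hasDerivAt (fun t _ => hg t)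
        (hcont.intervalIntegrable _ _)]
    have hp1 : δc ε 1 = δc ε 0 := by
      rw [hδc, hδc]
      congr 1
      funext e
      simpa using (hcl e).1 0
    have hp2 : tang (c ε) 1 = tang (c ε) 0 := by
      have h3 : cder (c ε) 1 = cder (c ε) 0 := by
        have h4 : (fun t => c ε (t + 1)) = c ε := funext (hcl ε).1
        have h5 := deriv_comp_add_const (c ε) 1 0
        rw [h4] at h5
        simpa [cder] using h5.symm
      rw [tang, tang, hLs, hLs, h3]
    rw [hp1, hp2]
    simp
  rw [hcurvint, Dth, (hg θ).deriv, hk, hLs]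
  field_simp
  ring
end
end

section
/- Let c(t,θ) be a smooth time-dependent closed planar curve such that each c(t,·) is uniformly parametrized, i.e. |c_θ(t,θ)| = ∫₀¹ |c_θ(t,θ')| dθ' for all t and θ. Set h := (∂_t c) · n and s := (∂_t c) · τ. Then at every (t,θ) one has |c_θ| · (D_θ s − h·κ) = −∫₀¹ h(t,θ') · κ(t,θ') · |c_θ(t,θ')| dθ'. -/
noncomputable section

/-- Leibniz rule for the dot product. -/
theorem hasDerivAt_dotp {f g : ℝ → ℝ × ℝ} {f' g' : ℝ × ℝ} {x : ℝ}
    (hf : HasDerivAt f f' x) (hg : HasDerivAt g g' x) :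
    HasDerivAt (fun y => dotp (f y) (g y)) (dotp f' (g x) + dotp (f x) g') x := by
  have f1 : HasDerivAt (fun y => (f y).1) f'.1 x := hf.fst
  have f2 : HasDerivAt (fun y => (f y).2) f'.2 x := hf.snd
  have g1 : HasDerivAt (fun y => (g y).1) g'.1 x := hg.fst
  have g2 : HasDerivAt (fun y => (g y).2) g'.2 x := hg.snd
  have := (f1.mul g1).add (f2.mul g2)
  refine this.congr_deriv ?_
  simp only [dotp]
  ring

theorem hasDerivAt_slice_right {G : ℝ × ℝ → ℝ × ℝ} (hG : Differentiable ℝ G) (t θ : ℝ) :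
    HasDerivAt (fun θ' => G (t, θ')) (fderiv ℝ G (t, θ) (0, 1)) θ :=
  (hG (t, θ)).hasFDerivAt.comp_hasDerivAt θ ((hasDerivAt_const θ t).prodMk (hasDerivAt_id θ))

theorem hasDerivAt_slice_left {G : ℝ × ℝ → ℝ × ℝ} (hG : Differentiable ℝ G) (t θ : ℝ) :
    HasDerivAt (fun t' => G (t', θ)) (fderiv ℝ G (t, θ) (1, 0)) t :=
  (hG (t, θ)).hasFDerivAt.comp_hasDerivAt t ((hasDerivAt_id t).prodMk (hasDerivAt_const t θ))

theorem fderiv_mixed {F : ℝ × ℝ → ℝ × ℝ} (hF : ContDiff ℝ (⊤ : ℕ∞) F) (p v w : ℝ × ℝ) :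
    fderiv ℝ (fun q => fderiv ℝ F q v) p w = fderiv ℝ (fun q => fderiv ℝ F q w) p v := by
  have hd : Differentiable ℝ (fderiv ℝ F) :=
    ((contDiff_infty.1 hF 2).fderiv_right (m := 1) (by norm_num)).differentiable (by norm_num)
  have key : ∀ v w : ℝ × ℝ,
      fderiv ℝ (fun q => fderiv ℝ F q v) p w = fderiv ℝ (fderiv ℝ F) p w v := by
    intro v w
    rw [fderiv_clm_apply (hd p) (differentiableAt_const v)]
    simp
  rw [key, key]
  have hsym : IsSymmSndFDerivAt ℝ F p := by
    apply (contDiff_infty.1 hF 2).contDiffAt.isSymmSndFDerivAt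
    simp only [minSmoothness_of_isRCLikeNormedField]
    norm_num
  exact hsym w v

/-- For a smooth time-dependent closed planar curve `c(t,θ)`, each of which
is uniformly parametrized (`|c_θ(t,θ)| = ∫₀¹ |c_θ(t,θ')| dθ'`), with `h = (∂_t c)·n` and
`s = (∂_t c)·τ`, one has `|c_θ| · (D_θ s − h·κ) = −∫₀¹ h·κ·|c_θ| dθ'`. -/
theorem uniform_parametrization_velocity_constraint
    (c : ℝ → ℝ → ℝ × ℝ)
    (hc : ContDiff ℝ (⊤ : ℕ∞) (fun p : ℝ × ℝ => c p.1 p.2))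
    (hcl : ∀ t, IsClosedCurve (c t))
    (hunif : ∀ t θ, speed (c t) θ = ∫ θ' in (0:ℝ)..1, speed (c t) θ')
    (h s : ℝ → ℝ → ℝ)
    (hh : ∀ t θ, h t θ = dotp (deriv (fun t' => c t' θ) t) (nvec (c t) θ))
    (hs : ∀ t θ, s t θ = dotp (deriv (fun t' => c t' θ) t) (tang (c t) θ)) :
    ∀ t θ,
      speed (c t) θ * (Dth (c t) (s t) θ - h t θ * curv (c t) θ)
        = -∫ θ' in (0:ℝ)..1, h t θ' * curv (c t) θ' * speed (c t) θ' := by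
  intro t
  set F : ℝ × ℝ → ℝ × ℝ := fun p => c p.1 p.2 with hFdef
  set A : ℝ × ℝ → ℝ × ℝ := fun p => fderiv ℝ F p (1, 0) with hA
  set B : ℝ × ℝ → ℝ × ℝ := fun p => fderiv ℝ F p (0, 1) with hB
  have hF1 : Differentiable ℝ F := hc.differentiable (by simp)
  have hfd : ContDiff ℝ 1 (fderiv ℝ F) := (contDiff_infty.1 hc 2).fderiv_right (by norm_num)
  have hA1 : ContDiff ℝ 1 A := hfd.clm_apply contDiff_const
  have hB1 : ContDiff ℝ 1 B := hfd.clm_apply contDiff_const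
  have hAd : Differentiable ℝ A := hA1.differentiable (by norm_num)
  have hBd : Differentiable ℝ B := hB1.differentiable (by norm_num)
  set M : ℝ → ℝ × ℝ := fun θ => fderiv ℝ A (t, θ) (0, 1) with hM
  set N : ℝ → ℝ × ℝ := fun θ => fderiv ℝ B (t, θ) (0, 1) with hN
  have hct : ∀ t θ, deriv (fun t' => c t' θ) t = A (t, θ) := fun t θ =>
    (hasDerivAt_slice_left hF1 t θ).deriv
  have hcθ : ∀ t θ, deriv (c t) θ = B (t, θ) := fun t θ =>
    (hasDerivAt_slice_right hF1 t θ).deriv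
  have hAθ : ∀ θ, HasDerivAt (fun θ' => A (t, θ')) (M θ) θ := fun θ =>
    hasDerivAt_slice_right hAd t θ
  have hBθ : ∀ θ, HasDerivAt (fun θ' => B (t, θ')) (N θ) θ := fun θ =>
    hasDerivAt_slice_right hBd t θ
  have hBt : ∀ θ, HasDerivAt (fun t' => B (t', θ)) (M θ) t := fun θ => by
    have := hasDerivAt_slice_left hBd t θ
    rwa [hB, fderiv_mixed hc] at this
  have hAc : Continuous fun θ => A (t, θ) := hA1.continuous.comp (by fun_prop)
  have hNc : Continuous N := by
    have h1 : Continuous (fderiv ℝ B) := hB1.continuous_fderiv (by norm_num)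
    exact (h1.comp (by fun_prop : Continuous fun θ : ℝ => (t, θ))).clm_apply continuous_const
  -- the speed
  have hsp : ∀ t θ, speed (c t) θ = speed (c t) 0 := fun t θ => by rw [hunif t θ, ← hunif t 0]
  have hnn : ∀ x : ℝ × ℝ, 0 ≤ dotp x x := fun x => by
    simp only [dotp]; nlinarith [mul_self_nonneg x.1, mul_self_nonneg x.2]
  have hsq : ∀ t θ, dotp (B (t, θ)) (B (t, θ)) = speed (c t) 0 ^ 2 := fun t θ => by
    rw [← hsp t θ, speed, nrm, cder, hcθ, Real.sq_sqrt (hnn _)]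
  set L := speed (c t) 0 with hL
  have hL0 : L ≠ 0 := by
    intro h0
    have h1 := hsq t 0
    rw [← hL, h0] at h1
    apply (hcl t).2 0
    rw [hcθ]
    simp only [dotp] at h1
    ext
    · simp only [Prod.fst_zero]; nlinarith [mul_self_nonneg (B (t, 0)).1, mul_self_nonneg (B (t, 0)).2]
    · simp only [Prod.snd_zero]; nlinarith [mul_self_nonneg (B (t, 0)).1, mul_self_nonneg (B (t, 0)).2]
  have hcomm : ∀ x y, dotp x y = dotp y x := fun x y => by simp only [dotp]; ring
  have hMB : ∀ θ, dotp (M θ) (B (t, θ)) = dotp (M 0) (B (t, 0)) := fun θ => by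
    have h1 := hasDerivAt_dotp (hBt θ) (hBt θ)
    have h2 := hasDerivAt_dotp (hBt 0) (hBt 0)
    simp only [hsq] at h1 h2
    have h3 := h1.unique h2
    rw [hcomm (B (t, θ)), hcomm (B (t, 0))] at h3
    linarith
  have hNB : ∀ θ, dotp (N θ) (B (t, θ)) = 0 := fun θ => by
    have h1 := hasDerivAt_dotp (hBθ θ) (hBθ θ)
    simp only [hsq] at h1
    have h3 := h1.unique (hasDerivAt_const θ _)
    rw [hcomm (B (t, θ))] at h3
    linarith
  have htang : tang (c t) = fun θ => L⁻¹ • B (t, θ) := by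
    funext θ; rw [tang, hsp, cder, hcθ]
  have hdtang : ∀ θ, deriv (tang (c t)) θ = L⁻¹ • N θ := fun θ => by
    rw [htang]; exact ((hBθ θ).const_smul L⁻¹).deriv
  have hst : s t = fun θ => L⁻¹ * dotp (A (t, θ)) (B (t, θ)) := by
    funext θ; rw [hs, hct, htang]; simp only [dotp, Prod.smul_fst, Prod.smul_snd, smul_eq_mul]; ring
  have hds : ∀ θ, HasDerivAt (s t)
      (L⁻¹ * dotp (M 0) (B (t, 0)) + L⁻¹ * dotp (A (t, θ)) (N θ)) θ := fun θ => by
    rw [hst]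
    have := (hasDerivAt_dotp (hAθ θ) (hBθ θ)).const_mul L⁻¹
    rwa [hMB, mul_add] at this
  have hint : ∀ θ, h t θ * curv (c t) θ * L = L⁻¹ * dotp (A (t, θ)) (N θ) := fun θ => by
    have e1 := hNB θ
    have e2 := hsq t θ
    rw [← hL] at e2
    rw [hh, hct, curv, nvec, DthV, hsp, hdtang, htang]
    simp only [dotp, Jrot, Prod.smul_fst, Prod.smul_snd, smul_eq_mul] at e1 e2 ⊢
    generalize (A (t, θ)).1 = a1 at *
    generalize (A (t, θ)).2 = a2 at *
    generalize (B (t, θ)).1 = b1 at *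
    generalize (B (t, θ)).2 = b2 at *
    generalize (N θ).1 = n1 at *
    generalize (N θ).2 = n2 at *
    rw [← hL]
    field_simp
    linear_combination (-(a1 * b1 + a2 * b2)) * e1 + (a1 * n1 + a2 * n2) * e2
  have hper : s t 1 = s t 0 := by
    have eA : A (t, 1) = A (t, 0) := by
      rw [← hct, ← hct]
      congr 1
      funext t'
      have := (hcl t').1 0
      rwa [zero_add] at this
    have eB : B (t, 1) = B (t, 0) := by
      rw [← hcθ, ← hcθ]
      have h1 : (fun x => c t (x + 1)) = c t := funext (hcl t).1
      have h2 := deriv_comp_add_const (c t) 1 0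
      rw [h1, zero_add] at h2
      exact h2.symm
    rw [hst]; simp only [eA, eB]
  have hANc : Continuous fun θ => L⁻¹ * dotp (A (t, θ)) (N θ) := by
    unfold dotp; fun_prop
  have hFTC := intervalIntegral.integral_eq_sub_of_hasDerivAt (a := 0) (b := 1)
    (fun θ _ => hds θ) ((continuous_const.add hANc).intervalIntegrable 0 1)
  rw [hper, sub_self, intervalIntegral.integral_add (by simp) (hANc.intervalIntegrable 0 1)] at hFTC
  simp only [intervalIntegral.integral_const, sub_zero, one_smul] at hFTC
  intro θ
  have hI : ∀ θ', h t θ' * curv (c t) θ' * speed (c t) θ' = L⁻¹ * dotp (A (t, θ')) (N θ') :=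
    fun θ' => by rw [hsp, ← hint]
  simp only [hI]
  rw [Dth, hsp, ← hL, (hds θ).deriv, mul_sub, mul_inv_cancel_left₀ hL0]
  have := hint θ
  linarith
end
end

section
/- Let c(t,θ) be a smooth time-dependent closed planar curve and set h := (∂_t c) · n, s := (∂_t c) · τ. Then at every (t,θ) the following two equations are equivalent: (A) ∂_t h = D_θ(s·h) − (κ/2)·h² + (1/(1+κ²))·( D_θ²(κ·h²) + κ²·(κ·h²) − h·(∂_t(1+κ²) − s·D_θ(1+κ²)) ), and (B) ∂_t h = D_θ(s·h) − (κ·(1+3κ²)/(2·(1+κ²)))·h² + (1/(1+κ²))·( D_θ²(κ·h²) − 2·κ·h·D_θ² h ). -/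
noncomputable section

namespace Unred

def Sm (F : ℝ → ℝ → ℝ) : Prop := ContDiff ℝ (⊤ : ℕ∞) (fun p : ℝ × ℝ => F p.1 p.2)
def Pt (F : ℝ → ℝ → ℝ) (t θ : ℝ) : ℝ := deriv (fun t' => F t' θ) t
def Px (F : ℝ → ℝ → ℝ) (t θ : ℝ) : ℝ := deriv (F t) θ

lemma Sm.ht_aux {F : ℝ → ℝ → ℝ} (hF : Sm F) (t θ : ℝ) :
    HasDerivAt (fun t' => F t' θ) (fderiv ℝ (fun p : ℝ × ℝ => F p.1 p.2) (t, θ) (1, 0)) t := by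
  have h1 : HasFDerivAt (fun p : ℝ × ℝ => F p.1 p.2) _ (t, θ) :=
    (hF.differentiable (by simp) (t, θ)).hasFDerivAt
  have h2 : HasDerivAt (fun t' : ℝ => (t', θ)) ((1 : ℝ), (0 : ℝ)) t :=
    (hasDerivAt_id t).prodMk (hasDerivAt_const t θ)
  exact h1.comp_hasDerivAt t h2

lemma Sm.hx_aux {F : ℝ → ℝ → ℝ} (hF : Sm F) (t θ : ℝ) :
    HasDerivAt (F t) (fderiv ℝ (fun p : ℝ × ℝ => F p.1 p.2) (t, θ) (0, 1)) θ := by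
  have h1 : HasFDerivAt (fun p : ℝ × ℝ => F p.1 p.2) _ (t, θ) :=
    (hF.differentiable (by simp) (t, θ)).hasFDerivAt
  have h2 : HasDerivAt (fun x' : ℝ => (t, x')) ((0 : ℝ), (1 : ℝ)) θ :=
    (hasDerivAt_const θ t).prodMk (hasDerivAt_id θ)
  exact h1.comp_hasDerivAt θ h2

lemma Sm.ht {F : ℝ → ℝ → ℝ} (hF : Sm F) (t θ : ℝ) :
    HasDerivAt (fun t' => F t' θ) (Pt F t θ) t := (hF.ht_aux t θ).differentiableAt.hasDerivAt

lemma Sm.hx {F : ℝ → ℝ → ℝ} (hF : Sm F) (t θ : ℝ) :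
    HasDerivAt (F t) (Px F t θ) θ := (hF.hx_aux t θ).differentiableAt.hasDerivAt

lemma Sm.Pt_eq {F : ℝ → ℝ → ℝ} (hF : Sm F) :
    Pt F = fun t θ => fderiv ℝ (fun p : ℝ × ℝ => F p.1 p.2) (t, θ) (1, 0) := by
  funext t θ; exact (hF.ht_aux t θ).deriv

lemma Sm.Px_eq {F : ℝ → ℝ → ℝ} (hF : Sm F) :
    Px F = fun t θ => fderiv ℝ (fun p : ℝ × ℝ => F p.1 p.2) (t, θ) (0, 1) := by
  funext t θ; exact (hF.hx_aux t θ).deriv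

lemma Sm.fd {F : ℝ → ℝ → ℝ} (hF : Sm F) :
    ContDiff ℝ (⊤ : ℕ∞) (fderiv ℝ (fun p : ℝ × ℝ => F p.1 p.2)) :=
  ContDiff.fderiv_right hF (by simp)

lemma Sm.smt {F : ℝ → ℝ → ℝ} (hF : Sm F) : Sm (Pt F) := by
  rw [hF.Pt_eq]; exact hF.fd.clm_apply contDiff_const

lemma Sm.smx {F : ℝ → ℝ → ℝ} (hF : Sm F) : Sm (Px F) := by
  rw [hF.Px_eq]; exact hF.fd.clm_apply contDiff_const

lemma Sm.comm {F : ℝ → ℝ → ℝ} (hF : Sm F) (t θ : ℝ) : Pt (Px F) t θ = Px (Pt F) t θ := by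
  rw [hF.smx.Pt_eq, hF.smt.Px_eq, hF.Px_eq, hF.Pt_eq]
  have hd := hF.fd.differentiable (by simp) (t, θ)
  have hs : IsSymmSndFDerivAt ℝ (fun p : ℝ × ℝ => F p.1 p.2) (t, θ) :=
    (ContDiff.contDiffAt hF).isSymmSndFDerivAt (by
      simp only [minSmoothness_of_isRCLikeNormedField]; exact WithTop.coe_le_coe.2 (le_top : (2 : ℕ∞) ≤ ⊤))
  have e : ∀ v w : ℝ × ℝ, fderiv ℝ (fun p : ℝ × ℝ =>
      fderiv ℝ (fun p : ℝ × ℝ => F p.1 p.2) (p.1, p.2) v) (t, θ) w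
      = fderiv ℝ (fderiv ℝ (fun p : ℝ × ℝ => F p.1 p.2)) (t, θ) w v := by
    intro v w
    have := (hd.hasFDerivAt.clm_apply (hasFDerivAt_const v (t, θ))).fderiv
    simp only [Prod.mk.eta]
    rw [this]; simp
  simp only [e]
  exact hs _ _

/-- The kinematic identity, in abstract form. -/
lemma kin (X Y g T1 T2 κ h s d : ℝ → ℝ → ℝ) (sX : Sm X) (sY : Sm Y) (sg : Sm g) (sT1 : Sm T1)
    (sT2 : Sm T2) (sκ : Sm κ) (sh : Sm h) (ss : Sm s) (sd : Sm d)
    (gpos : ∀ t θ, g t θ ≠ 0)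
    (unit : ∀ t θ, T1 t θ * T1 t θ + T2 t θ * T2 t θ = 1)
    (eX : ∀ t θ, Px X t θ = g t θ * T1 t θ) (eY : ∀ t θ, Px Y t θ = g t θ * T2 t θ)
    (eh : ∀ t θ, h t θ = - Pt X t θ * T2 t θ + Pt Y t θ * T1 t θ)
    (es : ∀ t θ, s t θ = Pt X t θ * T1 t θ + Pt Y t θ * T2 t θ)
    (ek : ∀ t θ, g t θ * κ t θ = T1 t θ * Px T2 t θ - T2 t θ * Px T1 t θ)
    (ed : ∀ t θ, g t θ * d t θ = Px h t θ) (t θ : ℝ) :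
    g t θ * Pt κ t θ - s t θ * Px κ t θ = Px d t θ + g t θ * (κ t θ ^ 2 * h t θ) := by
  have ux : ∀ t θ, T1 t θ * Px T1 t θ + T2 t θ * Px T2 t θ = 0 := by
    intro t θ
    have h1 := ((sT1.hx t θ).mul (sT1.hx t θ)).add ((sT2.hx t θ).mul (sT2.hx t θ))
    have h2 := h1.congr_of_eventuallyEq (f₁ := fun _ => 1)
      (Filter.Eventually.of_forall fun x => (unit t x).symm)
    have := h2.unique (hasDerivAt_const θ (1 : ℝ))
    linarith
  have ut : ∀ t θ, T1 t θ * Pt T1 t θ + T2 t θ * Pt T2 t θ = 0 := by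
    intro t θ
    have h1 := ((sT1.ht t θ).mul (sT1.ht t θ)).add ((sT2.ht t θ).mul (sT2.ht t θ))
    have h2 := h1.congr_of_eventuallyEq (f₁ := fun _ => 1)
      (Filter.Eventually.of_forall fun x => (unit x θ).symm)
    have := h2.unique (hasDerivAt_const t (1 : ℝ))
    linarith
  have vX : ∀ t θ, Pt X t θ = s t θ * T1 t θ - h t θ * T2 t θ := by
    intro t θ; rw [es, eh]; linear_combination (- Pt X t θ) * unit t θ
  have vY : ∀ t θ, Pt Y t θ = s t θ * T2 t θ + h t θ * T1 t θ := by
    intro t θ; rw [es, eh]; linear_combination (- Pt Y t θ) * unit t θ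
  have mX : ∀ t θ, Pt g t θ * T1 t θ + g t θ * Pt T1 t θ =
      (Px s t θ * T1 t θ + s t θ * Px T1 t θ) - (Px h t θ * T2 t θ + h t θ * Px T2 t θ) := by
    intro t θ
    have h1 := ((sg.ht t θ).mul (sT1.ht t θ)).congr_of_eventuallyEq
      (f₁ := fun t' => Px X t' θ) (Filter.Eventually.of_forall fun x => eX x θ)
    have h2 := (((ss.hx t θ).mul (sT1.hx t θ)).sub ((sh.hx t θ).mul (sT2.hx t θ))).congr_of_eventuallyEq
      (f₁ := Pt X t) (Filter.Eventually.of_forall fun x => vX t x)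
    have := sX.comm t θ
    rw [Pt, Px, h1.deriv, h2.deriv] at this
    exact this
  have mY : ∀ t θ, Pt g t θ * T2 t θ + g t θ * Pt T2 t θ =
      (Px s t θ * T2 t θ + s t θ * Px T2 t θ) + (Px h t θ * T1 t θ + h t θ * Px T1 t θ) := by
    intro t θ
    have h1 := ((sg.ht t θ).mul (sT2.ht t θ)).congr_of_eventuallyEq
      (f₁ := fun t' => Px Y t' θ) (Filter.Eventually.of_forall fun x => eY x θ)
    have h2 := (((ss.hx t θ).mul (sT2.hx t θ)).add ((sh.hx t θ).mul (sT1.hx t θ))).congr_of_eventuallyEq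
      (f₁ := Pt Y t) (Filter.Eventually.of_forall fun x => vY t x)
    have := sY.comm t θ
    rw [Pt, Px, h1.deriv, h2.deriv] at this
    exact this
  have T1x : ∀ t θ, Px T1 t θ = - (g t θ * κ t θ) * T2 t θ := by
    intro t θ; rw [ek]; linear_combination (- Px T1 t θ) * unit t θ + T1 t θ * ux t θ
  have T2x : ∀ t θ, Px T2 t θ = (g t θ * κ t θ) * T1 t θ := by
    intro t θ; rw [ek]; linear_combination (- Px T2 t θ) * unit t θ + T2 t θ * ux t θ
  -- angular velocity
  have om : ∀ t θ, T1 t θ * Pt T2 t θ - T2 t θ * Pt T1 t θ = d t θ + s t θ * κ t θ := by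
    intro t θ
    apply mul_left_cancel₀ (gpos t θ)
    have a := mX t θ
    have b := mY t θ
    rw [T1x, T2x, ← ed] at a b
    linear_combination T1 t θ * b - T2 t θ * a
      + (g t θ * d t θ + s t θ * g t θ * κ t θ) * unit t θ
  have gt : Pt g t θ = Px s t θ - h t θ * (g t θ * κ t θ) := by
    have a := mX t θ
    have b := mY t θ
    rw [T1x, T2x] at a b
    linear_combination T1 t θ * a + T2 t θ * b - g t θ * ut t θ
      + (Px s t θ - h t θ * (g t θ * κ t θ) - Pt g t θ) * unit t θ
  have T1t : Pt T1 t θ = - (d t θ + s t θ * κ t θ) * T2 t θ := by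
    rw [← om]; linear_combination (- Pt T1 t θ) * unit t θ + T1 t θ * ut t θ
  have T2t : Pt T2 t θ = (d t θ + s t θ * κ t θ) * T1 t θ := by
    rw [← om]; linear_combination (- Pt T2 t θ) * unit t θ + T2 t θ * ut t θ
  have k1 : Pt g t θ * κ t θ + g t θ * Pt κ t θ =
      (Pt T1 t θ * Px T2 t θ + T1 t θ * Pt (Px T2) t θ)
      - (Pt T2 t θ * Px T1 t θ + T2 t θ * Pt (Px T1) t θ) := by
    have h1 := (sg.ht t θ).mul (sκ.ht t θ)
    have h2 := (((sT1.ht t θ).mul (sT2.smx.ht t θ)).sub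
      ((sT2.ht t θ).mul (sT1.smx.ht t θ))).congr_of_eventuallyEq
      (f₁ := fun t' => g t' θ * κ t' θ) (Filter.Eventually.of_forall fun x => ek x θ)
    exact h1.unique h2
  have k2 : Px d t θ + (Px s t θ * κ t θ + s t θ * Px κ t θ) =
      (Px T1 t θ * Pt T2 t θ + T1 t θ * Px (Pt T2) t θ)
      - (Px T2 t θ * Pt T1 t θ + T2 t θ * Px (Pt T1) t θ) := by
    have h1 := (sd.hx t θ).add ((ss.hx t θ).mul (sκ.hx t θ))
    have h2 := (((sT1.hx t θ).mul (sT2.smt.hx t θ)).sub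
      ((sT2.hx t θ).mul (sT1.smt.hx t θ))).congr_of_eventuallyEq
      (f₁ := fun x => d t x + s t x * κ t x)
      (Filter.Eventually.of_forall fun x => (om t x).symm)
    exact h1.unique h2
  rw [sT1.comm, sT2.comm, gt, T1x, T2x, T1t, T2t] at k1
  rw [T1x, T2x, T1t, T2t] at k2
  linear_combination k1 - k2

end Unred

/-- For a smooth time-dependent closed planar curve with `h = (∂_t c)·n`
and `s = (∂_t c)·τ`, at every `(t,θ)` the equation
`∂_t h = D_θ(s·h) − (κ/2)·h² + (1/(1+κ²))·(D_θ²(κh²) + κ²·(κh²) − h·(∂_t(1+κ²) − s·D_θ(1+κ²)))`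
is equivalent to
`∂_t h = D_θ(s·h) − (κ(1+3κ²)/(2(1+κ²)))·h² + (1/(1+κ²))·(D_θ²(κh²) − 2κh·D_θ²h)`. -/
theorem unreduction_equation_equivalence
    (c : ℝ → ℝ → ℝ × ℝ)
    (hc : ContDiff ℝ (⊤ : ℕ∞) (fun p : ℝ × ℝ => c p.1 p.2))
    (hcl : ∀ t, IsClosedCurve (c t))
    (h s : ℝ → ℝ → ℝ)
    (hh : ∀ t θ, h t θ = dotp (deriv (fun t' => c t' θ) t) (nvec (c t) θ))
    (hs : ∀ t θ, s t θ = dotp (deriv (fun t' => c t' θ) t) (tang (c t) θ)) :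
    ∀ t θ,
      (deriv (fun t' => h t' θ) t
          = Dth (c t) (fun θ' => s t θ' * h t θ') θ
            - curv (c t) θ / 2 * h t θ ^ 2
            + (1 + curv (c t) θ ^ 2)⁻¹ *
              (Dth (c t) (fun θ' => Dth (c t) (fun θ'' => curv (c t) θ'' * h t θ'' ^ 2) θ') θ
                + curv (c t) θ ^ 2 * (curv (c t) θ * h t θ ^ 2)
                - h t θ * (deriv (fun t' => 1 + curv (c t') θ ^ 2) t
                    - s t θ * Dth (c t) (fun θ' => 1 + curv (c t) θ' ^ 2) θ)))
      ↔ (deriv (fun t' => h t' θ) t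
          = Dth (c t) (fun θ' => s t θ' * h t θ') θ
            - curv (c t) θ * (1 + 3 * curv (c t) θ ^ 2) / (2 * (1 + curv (c t) θ ^ 2))
              * h t θ ^ 2
            + (1 + curv (c t) θ ^ 2)⁻¹ *
              (Dth (c t) (fun θ' => Dth (c t) (fun θ'' => curv (c t) θ'' * h t θ'' ^ 2) θ') θ
                - 2 * curv (c t) θ * h t θ * Dth (c t) (fun θ' => Dth (c t) (h t) θ') θ)) := by
  have sX : Unred.Sm (fun t θ => (c t θ).1) := contDiff_fst.comp hc
  have sY : Unred.Sm (fun t θ => (c t θ).2) := contDiff_snd.comp hc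
  set X : ℝ → ℝ → ℝ := fun t θ => (c t θ).1 with hX
  set Y : ℝ → ℝ → ℝ := fun t θ => (c t θ).2 with hY
  have cx : ∀ t θ, deriv (c t) θ = (Unred.Px X t θ, Unred.Px Y t θ) := fun t θ =>
    ((sX.hx t θ).prodMk (sY.hx t θ)).deriv
  have ct : ∀ t θ, deriv (fun t' => c t' θ) t = (Unred.Pt X t θ, Unred.Pt Y t θ) := fun t θ =>
    ((sX.ht t θ).prodMk (sY.ht t θ)).deriv
  have qpos : ∀ t θ, Unred.Px X t θ * Unred.Px X t θ + Unred.Px Y t θ * Unred.Px Y t θ ≠ 0 := by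
    intro t θ h0
    apply (hcl t).2 θ
    rw [cx]
    have h1 : Unred.Px X t θ = 0 := by nlinarith [mul_self_nonneg (Unred.Px X t θ), mul_self_nonneg (Unred.Px Y t θ)]
    have h2 : Unred.Px Y t θ = 0 := by nlinarith [mul_self_nonneg (Unred.Px X t θ), mul_self_nonneg (Unred.Px Y t θ)]
    rw [h1, h2]; rfl
  have gdef : ∀ t θ, speed (c t) θ
      = Real.sqrt (Unred.Px X t θ * Unred.Px X t θ + Unred.Px Y t θ * Unred.Px Y t θ) := by
    intro t θ; simp only [speed, nrm, cder, dotp, cx]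
  have gsq : ∀ t θ, speed (c t) θ * speed (c t) θ
      = Unred.Px X t θ * Unred.Px X t θ + Unred.Px Y t θ * Unred.Px Y t θ := by
    intro t θ; rw [gdef]
    exact Real.mul_self_sqrt (add_nonneg (mul_self_nonneg _) (mul_self_nonneg _))
  have gpos : ∀ t θ, speed (c t) θ ≠ 0 := by
    intro t θ h0
    apply qpos t θ
    rw [← gsq, h0, zero_mul]
  have sg : Unred.Sm (fun t θ => speed (c t) θ) := by
    simp only [gdef]
    exact ContDiff.sqrt ((ContDiff.mul sX.smx sX.smx).add (ContDiff.mul sY.smx sY.smx))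
      (fun p => qpos p.1 p.2)
  have sgi : Unred.Sm (fun t θ => (speed (c t) θ)⁻¹) := ContDiff.inv sg (fun p => gpos p.1 p.2)
  have sT1 : Unred.Sm (fun t θ => (speed (c t) θ)⁻¹ * Unred.Px X t θ) := ContDiff.mul sgi sX.smx
  have sT2 : Unred.Sm (fun t θ => (speed (c t) θ)⁻¹ * Unred.Px Y t θ) := ContDiff.mul sgi sY.smx
  set T1 : ℝ → ℝ → ℝ := fun t θ => (speed (c t) θ)⁻¹ * Unred.Px X t θ with hT1
  set T2 : ℝ → ℝ → ℝ := fun t θ => (speed (c t) θ)⁻¹ * Unred.Px Y t θ with hT2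
  have tg : ∀ t, tang (c t) = fun θ => (T1 t θ, T2 t θ) := by
    intro t; funext θ
    simp [tang, cder, cx, hT1, hT2]
  have dtg : ∀ t θ, deriv (tang (c t)) θ = (Unred.Px T1 t θ, Unred.Px T2 t θ) := by
    intro t θ; rw [tg]
    exact ((sT1.hx t θ).prodMk (sT2.hx t θ)).deriv
  have kdef : ∀ t θ, curv (c t) θ
      = (speed (c t) θ)⁻¹ * (T1 t θ * Unred.Px T2 t θ - T2 t θ * Unred.Px T1 t θ) := by
    intro t θ
    simp only [curv, dotp, DthV, nvec, Jrot, dtg]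
    simp only [tg, Prod.smul_mk, smul_eq_mul]
    ring
  have sκ : Unred.Sm (fun t θ => curv (c t) θ) := by
    simp only [kdef]
    exact ContDiff.mul sgi ((ContDiff.mul sT1 sT2.smx).sub (ContDiff.mul sT2 sT1.smx))
  have eh : ∀ t θ, h t θ = - Unred.Pt X t θ * T2 t θ + Unred.Pt Y t θ * T1 t θ := by
    intro t θ; rw [hh, ct]; simp only [dotp, nvec, Jrot, tg]; ring
  have es : ∀ t θ, s t θ = Unred.Pt X t θ * T1 t θ + Unred.Pt Y t θ * T2 t θ := by
    intro t θ; rw [hs, ct]; simp only [dotp, tg]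
  have sh : Unred.Sm h := by
    simp only [Unred.Sm, eh]
    exact (ContDiff.mul (ContDiff.neg sX.smt) sT2).add (ContDiff.mul sY.smt sT1)
  have ss : Unred.Sm s := by
    simp only [Unred.Sm, es]
    exact (ContDiff.mul sX.smt sT1).add (ContDiff.mul sY.smt sT2)
  have sd : Unred.Sm (fun t θ => Dth (c t) (h t) θ) := ContDiff.mul sgi sh.smx
  intro t θ
  have key := Unred.kin X Y (fun t θ => speed (c t) θ) T1 T2 (fun t θ => curv (c t) θ) h s
    (fun t θ => Dth (c t) (h t) θ) sX sY sg sT1 sT2 sκ sh ss sd gpos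
    (by
      intro t θ
      have := gpos t θ
      simp only [hT1, hT2]
      field_simp
      linear_combination - gsq t θ)
    (by intro t θ; have := gpos t θ; simp only [hT1]; field_simp)
    (by intro t θ; have := gpos t θ; simp only [hT2]; field_simp)
    eh es
    (by intro t θ; have := gpos t θ; simp only [kdef]; field_simp)
    (by intro t θ; have := gpos t θ; simp only [Dth, Unred.Px]; field_simp)
    t θ
  have g0 := gpos t θ
  have D2 : Dth (c t) (fun θ' => Dth (c t) (h t) θ') θ
      = (speed (c t) θ)⁻¹ * Unred.Px (fun t θ => Dth (c t) (h t) θ) t θ := rfl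
  have E1 : deriv (fun t' => 1 + curv (c t') θ ^ 2) t
      = 2 * curv (c t) θ * Unred.Pt (fun t θ => curv (c t) θ) t θ := by
    have := (((sκ.ht t θ).pow 2).const_add 1).deriv
    refine Eq.trans this ?_
    simp
  have E2 : Dth (c t) (fun θ' => 1 + curv (c t) θ' ^ 2) θ
      = (speed (c t) θ)⁻¹ * (2 * curv (c t) θ * Unred.Px (fun t θ => curv (c t) θ) t θ) := by
    rw [Dth]
    have := (((sκ.hx t θ).pow 2).const_add 1).deriv
    congr 1
    refine Eq.trans this ?_
    simp
  have E3 : deriv (fun t' => 1 + curv (c t') θ ^ 2) t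
      - s t θ * Dth (c t) (fun θ' => 1 + curv (c t) θ' ^ 2) θ
      = 2 * curv (c t) θ * (Dth (c t) (fun θ' => Dth (c t) (h t) θ') θ
        + curv (c t) θ ^ 2 * h t θ) := by
    rw [E1, E2, D2]
    apply mul_left_cancel₀ g0
    field_simp
    linear_combination curv (c t) θ * key
  rw [E3]
  have k0 : (1 + curv (c t) θ ^ 2) ≠ 0 := by positivity
  generalize Dth (c t) (fun θ' => Dth (c t) (h t) θ') θ = A
  generalize Dth (c t) (fun θ' => Dth (c t) (fun θ'' => curv (c t) θ'' * h t θ'' ^ 2) θ') θ = B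
  generalize Dth (c t) (fun θ' => s t θ' * h t θ') θ = C
  generalize curv (c t) θ = k at *
  apply Eq.congr_right
  field_simp
  ring
end
end
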